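/- For a 3×3 complex matrix H with entries H_{ab}, a,b ∈ {1,2,3}, define the 3×3 matrix A(H) := [[H₁₁+H₂₂, H₃₂, −H₃₁], [H₂₃, H₁₁+H₃₃, H₂₁], [−H₁₃, H₁₂, H₂₂+H₃₃]]. Let H be Hermitian positive definite and K be Hermitian positive semidefinite, both 3×3. Then A(H) and A(H+K) are positive definite (in particular invertible), and for every v ∈ ℂ³ one has conj(v)ᵀ (A(H+K))⁻¹ v ≤ conj(v)ᵀ (A(H))⁻¹ v. -/

import Mathlib

open Matrix
open scoped ComplexOrder

/-- The matrix occurring in Hörmander's `L²` estimate for `(0,2)`-forms, built from a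
`3×3` matrix `H`. -/
def hormanderMatrix (H : Matrix (Fin 3) (Fin 3) ℂ) : Matrix (Fin 3) (Fin 3) ℂ :=
  !![H 0 0 + H 1 1, H 2 1, -(H 2 0);
     H 1 2, H 0 0 + H 2 2, H 1 0;
     -(H 0 2), H 0 1, H 1 1 + H 2 2]

lemma hormanderMatrix_add (H K : Matrix (Fin 3) (Fin 3) ℂ) :
    hormanderMatrix (H + K) = hormanderMatrix H + hormanderMatrix K := by
  ext i j
  fin_cases i <;> fin_cases j <;> simp [hormanderMatrix] <;> ring

lemma isHermitian_hormanderMatrix {H : Matrix (Fin 3) (Fin 3) ℂ} (hH : H.IsHermitian) :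
    (hormanderMatrix H).IsHermitian := by
  have h (i j : Fin 3) : (starRingEnd ℂ) (H i j) = H j i := hH.apply j i
  ext i j
  fin_cases i <;> fin_cases j <;> simp [hormanderMatrix, h]

/-- The quadratic form of `hormanderMatrix H` is a sum of values of the quadratic form of `Hᵀ`. -/
lemma dotProduct_hormanderMatrix_mulVec (H : Matrix (Fin 3) (Fin 3) ℂ) (v : Fin 3 → ℂ) :
    star v ⬝ᵥ (hormanderMatrix H *ᵥ v) =
      star ![0, v 0, v 1] ⬝ᵥ (Hᵀ *ᵥ ![0, v 0, v 1]) +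
      star ![-v 0, 0, v 2] ⬝ᵥ (Hᵀ *ᵥ ![-v 0, 0, v 2]) +
      star ![v 1, v 2, 0] ⬝ᵥ (Hᵀ *ᵥ ![v 1, v 2, 0]) := by
  simp [hormanderMatrix, dotProduct, mulVec, Fin.sum_univ_three]
  ring

lemma posSemidef_hormanderMatrix {H : Matrix (Fin 3) (Fin 3) ℂ} (hH : H.PosSemidef) :
    (hormanderMatrix H).PosSemidef := by
  refine .of_dotProduct_mulVec_nonneg (isHermitian_hormanderMatrix hH.isHermitian) fun v => ?_
  rw [dotProduct_hormanderMatrix_mulVec]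
  have h := hH.transpose.dotProduct_mulVec_nonneg
  exact add_nonneg (add_nonneg (h _) (h _)) (h _)

lemma posDef_hormanderMatrix {H : Matrix (Fin 3) (Fin 3) ℂ} (hH : H.PosDef) :
    (hormanderMatrix H).PosDef := by
  refine .of_dotProduct_mulVec_pos (isHermitian_hormanderMatrix hH.isHermitian) fun v hv => ?_
  rw [dotProduct_hormanderMatrix_mulVec]
  have h := hH.posSemidef.transpose.dotProduct_mulVec_nonneg
  by_cases h₁ : (![0, v 0, v 1] : Fin 3 → ℂ) = 0
  · have h₂ : (![v 1, v 2, 0] : Fin 3 → ℂ) ≠ 0 := by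
      intro h₂
      apply hv
      ext i
      fin_cases i
      · simpa using congrFun h₁ 1
      · simpa using congrFun h₂ 0
      · simpa using congrFun h₂ 1
    exact add_pos_of_nonneg_of_pos (add_nonneg (h _) (h _))
      (hH.transpose.dotProduct_mulVec_pos h₂)
  · exact add_pos_of_pos_of_nonneg
      (add_pos_of_pos_of_nonneg (hH.transpose.dotProduct_mulVec_pos h₁) (h _)) (h _)

/-- Matrix inversion is antitone on positive definite matrices. -/
lemma posSemidef_inv_sub_inv_add {n : Type*} [Fintype n] [DecidableEq n] {A P : Matrix n n ℂ}
    (hA : A.PosDef) (hP : P.PosSemidef) : (A⁻¹ - (A + P)⁻¹).PosSemidef := by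
  have hB : (A + P).PosDef := hA.add_posSemidef hP
  have hAu : IsUnit A.det := (isUnit_iff_isUnit_det A).1 hA.isUnit
  have hBu : IsUnit (A + P).det := (isUnit_iff_isUnit_det _).1 hB.isUnit
  have hAi : (A⁻¹)ᴴ = A⁻¹ := hA.inv.isHermitian
  have hBi : ((A + P)⁻¹)ᴴ = (A + P)⁻¹ := hB.inv.isHermitian
  have key : A⁻¹ - (A + P)⁻¹ =
      (A⁻¹ - (A + P)⁻¹)ᴴ * A * (A⁻¹ - (A + P)⁻¹) + ((A + P)⁻¹)ᴴ * P * (A + P)⁻¹ := by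
    rw [conjTranspose_sub, hAi, hBi]
    have hP' : (A + P)⁻¹ * P * (A + P)⁻¹ = (A + P)⁻¹ - (A + P)⁻¹ * A * (A + P)⁻¹ := by
      rw [eq_sub_iff_add_eq, ← add_mul, ← mul_add, add_comm P A, nonsing_inv_mul _ hBu, one_mul]
    rw [hP', sub_mul, nonsing_inv_mul _ hAu, sub_mul, one_mul, mul_sub, mul_assoc _ A A⁻¹,
      mul_nonsing_inv _ hAu, mul_one]
    abel
  rw [key]
  exact (hA.posSemidef.conjTranspose_mul_mul_same _).add (hP.conjTranspose_mul_mul_same _)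

/-- If `H` is Hermitian positive definite and `K` is Hermitian positive semidefinite,
then `A(H)` and `A(H+K)` are positive definite (hence invertible), and
`conj(v)ᵀ (A(H+K))⁻¹ v ≤ conj(v)ᵀ (A(H))⁻¹ v` for every `v`. -/
theorem stmt_11 (H K : Matrix (Fin 3) (Fin 3) ℂ) (hH : H.PosDef) (hK : K.PosSemidef) :
    (hormanderMatrix H).PosDef ∧ (hormanderMatrix (H + K)).PosDef ∧
    IsUnit (hormanderMatrix H) ∧ IsUnit (hormanderMatrix (H + K)) ∧
    ∀ v : Fin 3 → ℂ,
      (star v ⬝ᵥ ((hormanderMatrix (H + K))⁻¹ *ᵥ v)).im = 0 ∧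
      (star v ⬝ᵥ ((hormanderMatrix H)⁻¹ *ᵥ v)).im = 0 ∧
      (star v ⬝ᵥ ((hormanderMatrix (H + K))⁻¹ *ᵥ v)).re
        ≤ (star v ⬝ᵥ ((hormanderMatrix H)⁻¹ *ᵥ v)).re := by
  have hA := posDef_hormanderMatrix hH
  have hB := posDef_hormanderMatrix (hH.add_posSemidef hK)
  refine ⟨hA, hB, hA.isUnit, hB.isUnit, fun v => ?_⟩
  have h := (posSemidef_inv_sub_inv_add hA
    (posSemidef_hormanderMatrix hK)).dotProduct_mulVec_nonneg v
  rw [← hormanderMatrix_add, sub_mulVec, dotProduct_sub, sub_nonneg] at h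
  exact ⟨(Complex.le_def.1 (hB.inv.posSemidef.dotProduct_mulVec_nonneg v)).2.symm,
    (Complex.le_def.1 (hA.inv.posSemidef.dotProduct_mulVec_nonneg v)).2.symm,
    (Complex.le_def.1 h).1⟩
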